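/- Let λ/μ be a skew partition of size n, T a standard Young tableau of shape λ/μ, and τ any distinguished Schur labeling of shape λ/μ. Then the insertion tableau of read_τ(T) equals the transpose of the rectification of T: P(read_τ(T)) = Rect(T)ᵗ. In particular, P(read_τ(T)) does not depend on the choice of distinguished Schur labeling τ. -/

import Mathlib

/-- A skew partition `λ/μ`: a pair of Young diagrams with `μ ⊆ λ`. -/
structure SkewShape where
  outer : YoungDiagram
  inner : YoungDiagram
  le : inner ≤ outer

/-- The cells of the skew diagram `λ/μ` (pairs `(row, column)`). -/
def SkewShape.cells (s : SkewShape) : Finset (ℕ × ℕ) := s.outer.cells \ s.inner.cells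

/-- A bijective tableau of shape `λ/μ` of size `n`: a filling of the cells with the
`n` distinct entries of `Fin n`. -/
def IsBijFilling (s : SkewShape) (n : ℕ) (τ : ℕ × ℕ → Fin n) : Prop :=
  Set.BijOn τ ↑s.cells Set.univ

/-- A standard Young tableau of shape `λ/μ`: a bijective filling whose rows increase
left to right and whose columns increase top to bottom. -/
def IsSYT (s : SkewShape) (n : ℕ) (T : ℕ × ℕ → Fin n) : Prop :=
  IsBijFilling s n T ∧
  (∀ i j, (i, j) ∈ s.cells → (i, j + 1) ∈ s.cells → T (i, j) < T (i, j + 1)) ∧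
  (∀ i j, (i, j) ∈ s.cells → (i + 1, j) ∈ s.cells → T (i, j) < T (i + 1, j))

/-- A Schur labeling: a bijective filling whose rows strictly decrease left to right
and whose columns strictly increase top to bottom. -/
def IsSchurLabeling (s : SkewShape) (n : ℕ) (τ : ℕ × ℕ → Fin n) : Prop :=
  IsBijFilling s n τ ∧
  (∀ i j, (i, j) ∈ s.cells → (i, j + 1) ∈ s.cells → τ (i, j + 1) < τ (i, j)) ∧
  (∀ i j, (i, j) ∈ s.cells → (i + 1, j) ∈ s.cells → τ (i, j) < τ (i + 1, j))

/-- A distinguished Schur labeling: `τ_B ≥ τ_{B'}` whenever `B` is weakly below and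
weakly left of `B'`. -/
def IsDistinguished (s : SkewShape) (n : ℕ) (τ : ℕ × ℕ → Fin n) : Prop :=
  IsSchurLabeling s n τ ∧
  ∀ B ∈ s.cells, ∀ B' ∈ s.cells, B'.1 ≤ B.1 → B.2 ≤ B'.2 → τ B' ≤ τ B

/-- `π = read_τ(T)`, i.e. `π(τ(B)) = T(B)` for every box `B`; since `τ` is a bijective
filling this determines `π` completely. -/
def IsReading (s : SkewShape) {n : ℕ} (τ T : ℕ × ℕ → Fin n) (π : Equiv.Perm (Fin n)) : Prop :=
  ∀ B ∈ s.cells, π (τ B) = T B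

/-- The poset `poset(τ)` on labels: `x ≤ y` iff the box of `x` is weakly upper-left of
the box of `y`. -/
def posetRel (s : SkewShape) {n : ℕ} (τ : ℕ × ℕ → Fin n) (x y : Fin n) : Prop :=
  ∃ B ∈ s.cells, ∃ B' ∈ s.cells, τ B = x ∧ τ B' = y ∧ B.1 ≤ B'.1 ∧ B.2 ≤ B'.2

/-- The right inversion set `Inv_R(σ) = {(σ(i),σ(j)) : i < j, σ(i) > σ(j)}`. -/
def InvR {n : ℕ} (σ : Equiv.Perm (Fin n)) : Set (Fin n × Fin n) :=
  {p | p.2 < p.1 ∧ σ⁻¹ p.1 < σ⁻¹ p.2}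

/-- The right weak Bruhat order: `σ ≤_R ρ` iff `Inv_R(σ) ⊆ Inv_R(ρ)`. -/
def rLE {n : ℕ} (σ ρ : Equiv.Perm (Fin n)) : Prop := InvR σ ⊆ InvR ρ

/-- The left inversion set. -/
def InvL {n : ℕ} (σ : Equiv.Perm (Fin n)) : Set (Fin n × Fin n) :=
  {p | p.1 < p.2 ∧ σ p.2 < σ p.1}

/-- The left weak Bruhat order. -/
def lLE {n : ℕ} (σ ρ : Equiv.Perm (Fin n)) : Prop := InvL σ ⊆ InvL ρ

/-- `τ` is the Schur labeling `τ₀`, filling `1,…,n` right-to-left along rows starting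
with the top row: characterized by its bijectivity together with the induced order of
the boxes. -/
def IsTau0 (s : SkewShape) (n : ℕ) (τ : ℕ × ℕ → Fin n) : Prop :=
  IsBijFilling s n τ ∧
  ∀ B ∈ s.cells, ∀ B' ∈ s.cells, B ≠ B' →
    (τ B < τ B' ↔ (B.1 < B'.1 ∨ (B.1 = B'.1 ∧ B'.2 < B.2)))

/-- `τ` is the Schur labeling `τ₁`, filling `1,…,n` top-to-bottom along columns starting
with the rightmost column. -/
def IsTau1 (s : SkewShape) (n : ℕ) (τ : ℕ × ℕ → Fin n) : Prop :=
  IsBijFilling s n τ ∧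
  ∀ B ∈ s.cells, ∀ B' ∈ s.cells, B ≠ B' →
    (τ B < τ B' ↔ (B'.2 < B.2 ∨ (B.2 = B'.2 ∧ B.1 < B'.1)))

/-- `T` is the standard Young tableau `T_{λ/μ}`, filling `1,…,n` row by row from the
top, left to right in each row. -/
def IsRowTab (s : SkewShape) (n : ℕ) (T : ℕ × ℕ → Fin n) : Prop :=
  IsBijFilling s n T ∧
  ∀ B ∈ s.cells, ∀ B' ∈ s.cells, B ≠ B' →
    (T B < T B' ↔ (B.1 < B'.1 ∨ (B.1 = B'.1 ∧ B.2 < B'.2)))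

/-- `T` is the standard Young tableau `T'_{λ/μ}`, filling `1,…,n` column by column from
the leftmost column, top to bottom in each column. -/
def IsColTab (s : SkewShape) (n : ℕ) (T : ℕ × ℕ → Fin n) : Prop :=
  IsBijFilling s n T ∧
  ∀ B ∈ s.cells, ∀ B' ∈ s.cells, B ≠ B' →
    (T B < T B' ↔ (B.2 < B'.2 ∨ (B.2 = B'.2 ∧ B.1 < B'.1)))

/-- Schensted row insertion: insert `x` into a row, returning the new row and the
bumped entry (if any). -/
def insRow (x : ℕ) : List ℕ → List ℕ × Option ℕ
  | [] => ([x], none)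
  | y :: ys =>
    if y ≤ x then
      let p := insRow x ys
      (y :: p.1, p.2)
    else (x :: ys, some y)

/-- Schensted insertion of an entry into a tableau (a list of rows). -/
def insTab : List (List ℕ) → ℕ → List (List ℕ)
  | [], x => [[x]]
  | row :: rest, x =>
    match insRow x row with
    | (row', none) => row' :: rest
    | (row', some y) => row' :: insTab rest y

/-- The Robinson–Schensted insertion tableau `P(σ)` of a permutation, obtained by
inserting the one-line word of `σ` from left to right. -/
def Ptab {n : ℕ} (σ : Equiv.Perm (Fin n)) : List (List ℕ) :=
  (List.ofFn fun i => (σ i : ℕ)).foldl insTab []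

/-- The shape of a tableau: the list of its row lengths. -/
def shapeOf (t : List (List ℕ)) : List ℕ := t.map List.length

/-- Dominance order on partitions (as lists): `domList a b` means `b` dominates `a`,
i.e. every partial sum of `b` is at least the corresponding partial sum of `a`. -/
def domList (a b : List ℕ) : Prop := ∀ i, (a.take i).sum ≤ (b.take i).sum

/-- The longest element `w₀` of `S_n`, i.e. the reversal `k ↦ n - 1 - k`. -/
def w0 (n : ℕ) : Equiv.Perm (Fin n) := Fin.revPerm

/-- The rectification of a standard Young tableau `T` of skew shape, computed via the
fact `Rect(T) = P(read_{τ₀}(T)·w₀)`. -/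
def RectOf {n : ℕ} (π₀ : Equiv.Perm (Fin n)) : List (List ℕ) := Ptab (π₀ * w0 n)

/-! ### Row scanning -/

/-- Insert a word into a row, collecting the word of bumped entries. -/
def scanRow : List ℕ → List ℕ → List ℕ × List ℕ
  | r, [] => (r, [])
  | r, x :: w =>
    ((scanRow (insRow x r).1 w).1, (insRow x r).2.toList ++ (scanRow (insRow x r).1 w).2)

/-- Insertion tableau of a word. -/
def pWord (w : List ℕ) : List (List ℕ) := w.foldl insTab []

theorem insTab_cons (row : List ℕ) (rest : List (List ℕ)) (x : ℕ) :
    insTab (row :: rest) x = (insRow x row).1 :: (insRow x row).2.toList.foldl insTab rest := by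
  rw [insTab]
  rcases h : insRow x row with ⟨r, _ | y⟩ <;> simp

theorem foldl_insTab_cons (w : List ℕ) : ∀ (row : List ℕ) (rest : List (List ℕ)),
    w.foldl insTab (row :: rest) = (scanRow row w).1 :: (scanRow row w).2.foldl insTab rest := by
  induction w with
  | nil => intro row rest; simp [scanRow]
  | cons x w ih =>
    intro row rest
    rw [List.foldl_cons, insTab_cons, ih]
    simp [scanRow, List.foldl_append]

theorem pWord_cons (x : ℕ) (w : List ℕ) :
    pWord (x :: w) = (scanRow [] (x :: w)).1 :: pWord (scanRow [] (x :: w)).2 := by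
  have : pWord (x :: w) = w.foldl insTab ([x] :: []) := rfl
  rw [this, foldl_insTab_cons]
  simp [scanRow, insRow, pWord]

theorem scanRow_append (u v : List ℕ) : ∀ r : List ℕ,
    scanRow r (u ++ v) =
      ((scanRow (scanRow r u).1 v).1, (scanRow r u).2 ++ (scanRow (scanRow r u).1 v).2) := by
  induction u with
  | nil => intro r; simp [scanRow]
  | cons x u ih => intro r; simp [scanRow, ih]

theorem insRow_length (x : ℕ) (r : List ℕ) :
    (insRow x r).1.length + (insRow x r).2.toList.length = r.length + 1 := by
  induction r with
  | nil => simp [insRow]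
  | cons a r ih =>
    rw [insRow]
    split_ifs
    · simp; omega
    · simp

theorem insRow_mem (x : ℕ) (r : List ℕ) : ∀ z ∈ (insRow x r).1, z = x ∨ z ∈ r := by
  induction r with
  | nil => simp [insRow]
  | cons a r ih =>
    rw [insRow]
    split_ifs
    · intro z hz
      simp at hz
      rcases hz with rfl | hz
      · simp
      · rcases ih z hz with h | h <;> simp [h]
    · intro z hz
      simp at hz
      rcases hz with rfl | hz <;> simp [*]

theorem insRow_bump_mem (x : ℕ) (r : List ℕ) : ∀ z ∈ (insRow x r).2, z ∈ r ∧ x < z := by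
  induction r with
  | nil => simp [insRow]
  | cons a r ih =>
    rw [insRow]
    split_ifs with h
    · intro z hz
      have := ih z hz
      simp [this]
    · intro z hz
      simp at hz
      subst hz
      simp; omega

theorem insRow_sorted (x : ℕ) (r : List ℕ) (h : r.Pairwise (· ≤ ·)) :
    (insRow x r).1.Pairwise (· ≤ ·) := by
  induction r with
  | nil => simp [insRow]
  | cons a r ih =>
    rw [List.pairwise_cons] at h
    rw [insRow]
    split_ifs with hx
    · simp only [List.pairwise_cons]
      refine ⟨fun z hz => ?_, ih h.2⟩
      rcases insRow_mem x r z hz with rfl | hz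
      · exact hx
      · exact h.1 z hz
    · simp only [List.pairwise_cons]
      refine ⟨fun z hz => ?_, h.2⟩
      have := h.1 z hz
      omega

theorem scanRow_sorted (w : List ℕ) : ∀ (r : List ℕ), r.Pairwise (· ≤ ·) →
    (scanRow r w).1.Pairwise (· ≤ ·) := by
  induction w with
  | nil => intro r h; simpa [scanRow] using h
  | cons x w ih => intro r h; exact ih _ (insRow_sorted x r h)

theorem scanRow_length (w : List ℕ) : ∀ (r : List ℕ),
    (scanRow r w).1.length + (scanRow r w).2.length = r.length + w.length := by
  induction w with
  | nil => intro r; simp [scanRow]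
  | cons x w ih =>
    intro r
    have := ih (insRow x r).1
    have := insRow_length x r
    simp [scanRow]; omega

theorem insRow_length_le (x : ℕ) (r : List ℕ) : 1 ≤ (insRow x r).1.length := by
  cases r with
  | nil => simp [insRow]
  | cons a r => rw [insRow]; split_ifs <;> simp

theorem scanRow_row_length (w : List ℕ) : ∀ (r : List ℕ), 1 ≤ r.length →
    1 ≤ (scanRow r w).1.length := by
  induction w with
  | nil => intro r h; simpa [scanRow] using h
  | cons x w ih => intro r h; exact ih _ (insRow_length_le x r)

/-! ### Knuth relations -/

/-- Elementary Knuth relations in context. -/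
inductive KStep : List ℕ → List ℕ → Prop
  | k1 (u v : List ℕ) (x y z : ℕ) : x < y → y ≤ z →
      KStep (u ++ [y, x, z] ++ v) (u ++ [y, z, x] ++ v)
  | k2 (u v : List ℕ) (x y z : ℕ) : x ≤ y → y < z →
      KStep (u ++ [x, z, y] ++ v) (u ++ [z, x, y] ++ v)

/-- Knuth equivalence. -/
def KEq : List ℕ → List ℕ → Prop := Relation.EqvGen KStep

theorem KEq.refl (w : List ℕ) : KEq w w := Relation.EqvGen.refl w

theorem KEq.of_eq {w w' : List ℕ} (h : w = w') : KEq w w' := h ▸ KEq.refl w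

theorem KEq.symm {w w' : List ℕ} (h : KEq w w') : KEq w' w := Relation.EqvGen.symm _ _ h

theorem KEq.trans {a b c : List ℕ} (h : KEq a b) (h' : KEq b c) : KEq a c :=
  Relation.EqvGen.trans _ _ _ h h'

theorem KStep.ctx {a b : List ℕ} (h : KStep a b) (p q : List ℕ) :
    KStep (p ++ a ++ q) (p ++ b ++ q) := by
  cases h with
  | k1 u v x y z h1 h2 =>
    have := KStep.k1 (p ++ u) (v ++ q) x y z h1 h2
    simpa using this
  | k2 u v x y z h1 h2 =>
    have := KStep.k2 (p ++ u) (v ++ q) x y z h1 h2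
    simpa using this

theorem KEq.ctx {a b : List ℕ} (h : KEq a b) (p q : List ℕ) :
    KEq (p ++ a ++ q) (p ++ b ++ q) := by
  induction h with
  | rel a b h => exact Relation.EqvGen.rel _ _ (h.ctx p q)
  | refl a => exact KEq.refl _
  | symm a b _ ih => exact ih.symm
  | trans a b c _ _ ih1 ih2 => exact ih1.trans ih2

theorem KEq.left {a b : List ℕ} (h : KEq a b) (p : List ℕ) : KEq (p ++ a) (p ++ b) := by
  simpa using h.ctx p []

theorem KEq.right {a b : List ℕ} (h : KEq a b) (q : List ℕ) : KEq (a ++ q) (b ++ q) := by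
  simpa using h.ctx [] q

theorem KEq.k1 {x y z : ℕ} (v : List ℕ) (h1 : x < y) (h2 : y ≤ z) :
    KEq (y :: x :: z :: v) (y :: z :: x :: v) :=
  Relation.EqvGen.rel _ _ (KStep.k1 [] v x y z h1 h2)

theorem KEq.k2 {x y z : ℕ} (v : List ℕ) (h1 : x ≤ y) (h2 : y < z) :
    KEq (x :: z :: y :: v) (z :: x :: y :: v) :=
  Relation.EqvGen.rel _ _ (KStep.k2 [] v x y z h1 h2)

theorem KStep.perm {a b : List ℕ} (h : KStep a b) : a.Perm b := by
  cases h with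
  | k1 u v x y z h1 h2 =>
    exact (List.Perm.append_left u ((List.Perm.swap z x []).cons y)).append_right v
  | k2 u v x y z h1 h2 =>
    exact (List.Perm.append_left u (List.Perm.swap z x [y])).append_right v

theorem KEq.perm {a b : List ℕ} (h : KEq a b) : a.Perm b := by
  induction h with
  | rel a b h => exact h.perm
  | refl a => exact List.Perm.refl _
  | symm a b _ ih => exact ih.symm
  | trans a b c _ _ ih1 ih2 => exact ih1.trans ih2

theorem KStep.reverse {a b : List ℕ} (h : KStep a b) (hn : a.Nodup) :
    KEq a.reverse b.reverse := by
  cases h with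
  | k1 u v x y z h1 h2 =>
    have hyz : y ≠ z := by
      rintro rfl
      simp [List.nodup_append] at hn
    have := (KEq.k2 (x := x) (y := y) (z := z) u.reverse h1.le (by omega)).left v.reverse
    simpa using this.symm
  | k2 u v x y z h1 h2 =>
    have hyz : x ≠ y := by
      rintro rfl
      simp [List.nodup_append] at hn
    have := (KEq.k1 (x := x) (y := y) (z := z) u.reverse (by omega) h2.le).left v.reverse
    simpa using this.symm

theorem KEq.reverse {a b : List ℕ} (h : KEq a b) : a.Nodup → KEq a.reverse b.reverse := by
  induction h with
  | rel a b h => exact h.reverse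
  | refl a => exact fun _ => KEq.refl _
  | symm a b h ih =>
    intro hn
    exact (ih ((KEq.perm h).nodup_iff.2 hn)).symm
  | trans a b c h _ ih1 ih2 =>
    intro hn
    exact (ih1 hn).trans (ih2 ((KEq.perm h).nodup_iff.1 hn))

/-! ### Row insertion respects the Knuth relations -/

theorem scan_pass {a : ℕ} : ∀ (w : List ℕ) (r : List ℕ), (∀ x ∈ w, a ≤ x) →
    scanRow (a :: r) w = (a :: (scanRow r w).1, (scanRow r w).2) := by
  intro w
  induction w with
  | nil => intro r _; simp [scanRow]
  | cons x w ih =>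
    intro r h
    have hx : a ≤ x := h x (by simp)
    simp only [scanRow, insRow, hx, if_true]
    rw [ih _ (fun z hz => h z (by simp [hz]))]

/-- Inserting `y ≤ z` in this order. -/
theorem ins_le (y z : ℕ) (hyz : y ≤ z) (r : List ℕ) (h : r.Pairwise (· ≤ ·)) :
    (insRow z (insRow y r).1).2 = none ∨
    ∃ y' z', (insRow y r).2 = some y' ∧ (insRow z (insRow y r).1).2 = some z' ∧ y' ≤ z' := by
  induction r with
  | nil => left; simp [insRow, hyz]
  | cons a r ih =>
    rw [List.pairwise_cons] at h
    by_cases hay : a ≤ y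
    · have haz : a ≤ z := hay.trans hyz
      simpa [insRow, hay, haz] using ih h.2
    · simp only [insRow, hay, if_false, hyz, if_true]
      rcases hq : (insRow z r).2 with _ | z'
      · left; rfl
      · right
        exact ⟨a, z', rfl, rfl, h.1 _ (insRow_bump_mem z r z' hq).1⟩

/-- Inserting `z` and then a smaller `y`. -/
theorem ins_gt (y z : ℕ) (hyz : y < z) (r : List ℕ) (h : r.Pairwise (· ≤ ·)) :
    ∃ y', (insRow y (insRow z r).1).2 = some y' ∧ y' ≤ z := by
  induction r with
  | nil => exact ⟨z, by simp [insRow, hyz.not_ge], le_rfl⟩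
  | cons a r ih =>
    rw [List.pairwise_cons] at h
    by_cases haz : a ≤ z
    · by_cases hay : a ≤ y
      · simpa [insRow, hay, haz] using ih h.2
      · exact ⟨a, by simp [insRow, hay, haz], haz⟩
    · exact ⟨z, by simp [insRow, haz, hyz.not_ge], le_rfl⟩

theorem scan_k1 (x y z : ℕ) (hxy : x < y) (hyz : y ≤ z) (r : List ℕ)
    (h : r.Pairwise (· ≤ ·)) :
    (scanRow r [y, x, z]).1 = (scanRow r [y, z, x]).1 ∧
      KEq (scanRow r [y, x, z]).2 (scanRow r [y, z, x]).2 := by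
  have hyx : ¬ y ≤ x := by omega
  have hxz : x ≤ z := by omega
  induction r with
  | nil =>
    simp [scanRow, insRow, hyx, hxz, hyz]
    exact KEq.refl _
  | cons a r ih =>
    rw [List.pairwise_cons] at h
    by_cases hax : a ≤ x
    · have h1 : ∀ t ∈ [y, x, z], a ≤ t := by simp; omega
      have h2 : ∀ t ∈ [y, z, x], a ≤ t := by simp; omega
      rw [scan_pass _ _ h1, scan_pass _ _ h2]
      exact ⟨by rw [(ih h.2).1], (ih h.2).2⟩
    · by_cases hay : a ≤ y
      · have haz : a ≤ z := by omega
        simp only [scanRow, insRow, hay, hax, haz, hxz, if_true, if_false]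
        refine ⟨by trivial, ?_⟩
        rcases ins_le y z hyz r h.2 with h0 | ⟨y', z', e1, e2, hle⟩
        · rw [h0]; exact KEq.refl _
        · rw [e1, e2]
          simp only [Option.toList_some, List.append_nil, List.singleton_append]
          have hm := insRow_bump_mem y r y' e1
          exact KEq.k1 [] (by omega) hle
      · simp only [scanRow, insRow, hay, hyx, hyz, hxz, if_true, if_false]
        refine ⟨by trivial, ?_⟩
        rcases hq : (insRow z r).2 with _ | z'
        · exact KEq.refl _
        · simp only [Option.toList_some, List.append_nil, List.singleton_append]
          exact KEq.k1 [] (by omega) (h.1 _ (insRow_bump_mem z r z' hq).1)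

theorem scan_k2 (x y z : ℕ) (hxy : x ≤ y) (hyz : y < z) (r : List ℕ)
    (h : r.Pairwise (· ≤ ·)) :
    (scanRow r [x, z, y]).1 = (scanRow r [z, x, y]).1 ∧
      KEq (scanRow r [x, z, y]).2 (scanRow r [z, x, y]).2 := by
  have hzy : ¬ z ≤ y := by omega
  have hzx : ¬ z ≤ x := by omega
  have hxz : x ≤ z := by omega
  induction r with
  | nil =>
    simp [scanRow, insRow, hzy, hxz, hxy, hzx]
    exact KEq.refl _
  | cons a r ih =>
    rw [List.pairwise_cons] at h
    by_cases hax : a ≤ x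
    · have h1 : ∀ t ∈ [x, z, y], a ≤ t := by simp; omega
      have h2 : ∀ t ∈ [z, x, y], a ≤ t := by simp; omega
      rw [scan_pass _ _ h1, scan_pass _ _ h2]
      exact ⟨by rw [(ih h.2).1], (ih h.2).2⟩
    · by_cases haz : a ≤ z
      · simp only [scanRow, insRow, hax, haz, hxz, hxy, if_true, if_false]
        refine ⟨by trivial, ?_⟩
        obtain ⟨y', e, hy'⟩ := ins_gt y z hyz r h.2
        rw [e]
        rcases hq : (insRow z r).2 with _ | z'
        · exact KEq.refl _
        · simp only [Option.toList_some, List.append_nil, List.singleton_append]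
          have hm := insRow_bump_mem z r z' hq
          have hm' := insRow_bump_mem y _ y' e
          have hay : a ≤ y' := by
            rcases insRow_mem z r y' hm'.1 with h' | h'
            · omega
            · exact h.1 _ h'
          exact KEq.k2 [] hay (by omega)
      · cases r with
        | nil =>
          simp [scanRow, insRow, hax, haz, hzy, hxz, hxy, hzx]
          exact KEq.refl _
        | cons b r =>
          have hab : a ≤ b := h.1 b (by simp)
          have hbz : ¬ b ≤ z := by omega
          have hby : ¬ b ≤ y := by omega
          simp only [scanRow, insRow, hax, haz, hxz, hxy, hbz, hby, hzy, hzx, if_true, if_false]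
          refine ⟨by trivial, ?_⟩
          exact (KEq.k1 [] (by omega) hab).symm

theorem KStep.scan {a b : List ℕ} (h : KStep a b) (r : List ℕ) (hr : r.Pairwise (· ≤ ·)) :
    (scanRow r a).1 = (scanRow r b).1 ∧ KEq (scanRow r a).2 (scanRow r b).2 := by
  cases h with
  | k1 u v x y z h1 h2 =>
    have := scan_k1 x y z h1 h2 _ (scanRow_sorted u r hr)
    simp only [scanRow_append]
    rw [this.1]
    exact ⟨rfl, (this.2.left _).right _⟩
  | k2 u v x y z h1 h2 =>
    have := scan_k2 x y z h1 h2 _ (scanRow_sorted u r hr)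
    simp only [scanRow_append]
    rw [this.1]
    exact ⟨rfl, (this.2.left _).right _⟩

theorem KEq.scan {a b : List ℕ} (h : KEq a b) (r : List ℕ) (hr : r.Pairwise (· ≤ ·)) :
    (scanRow r a).1 = (scanRow r b).1 ∧ KEq (scanRow r a).2 (scanRow r b).2 := by
  induction h with
  | rel a b h => exact h.scan r hr
  | refl a => exact ⟨rfl, KEq.refl _⟩
  | symm a b _ ih => exact ⟨ih.1.symm, ih.2.symm⟩
  | trans a b c _ _ ih1 ih2 => exact ⟨ih1.1.trans ih2.1, ih1.2.trans ih2.2⟩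

theorem KEq.pWord_eq : ∀ (n : ℕ) {a b : List ℕ}, a.length ≤ n → KEq a b → pWord a = pWord b := by
  intro n
  induction n with
  | zero =>
    intro a b hl h
    have := h.perm.length_eq
    rw [List.length_eq_zero_iff.1 (by omega : a.length = 0),
      List.length_eq_zero_iff.1 (by omega : b.length = 0)]
  | succ n ih =>
    intro a b hl h
    have hlen := h.perm.length_eq
    rcases a with _ | ⟨x, a⟩
    · rw [List.length_eq_zero_iff.1 (by simpa using hlen.symm : b.length = 0)]
    · rcases b with _ | ⟨y, b⟩
      · simp at hlen
      · rw [pWord_cons, pWord_cons]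
        have hs := h.scan [] List.Pairwise.nil
        rw [hs.1, ih _ hs.2]
        have h1 := scanRow_length (x :: a) []
        have h2 := scanRow_row_length a [x] (by simp)
        have h3 : (scanRow [] (x :: a)).1 = (scanRow [x] a).1 := rfl
        rw [h3] at h1
        simp at h1 hl h2 ⊢
        omega

/-! ### A word is Knuth equivalent to the row reading of its insertion tableau -/

theorem row_knuth_aux (x : ℕ) : ∀ (r : List ℕ) (a : ℕ), x < a → (a :: r).Pairwise (· ≤ ·) →
    KEq (a :: (r ++ [x])) (a :: x :: r) := by
  intro r
  induction r with
  | nil => intro a _ _; exact KEq.refl _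
  | cons b r ih =>
    intro a hx h
    rw [List.pairwise_cons] at h
    have hab := h.1 b (by simp)
    have h1 := (ih b (by omega) h.2).left [a]
    exact h1.trans (KEq.k1 r hx hab).symm

theorem row_knuth (x : ℕ) (r : List ℕ) (h : r.Pairwise (· ≤ ·)) :
    KEq (r ++ [x]) ((insRow x r).2.toList ++ (insRow x r).1) := by
  induction r with
  | nil => exact KEq.refl _
  | cons a r ih =>
    have h' := h
    rw [List.pairwise_cons] at h
    by_cases hax : a ≤ x
    · simp only [insRow, hax, if_true]
      have h1 := (ih h.2).left [a]
      refine KEq.trans (by simpa using h1) ?_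
      rcases hq : (insRow x r).2 with _ | x'
      · exact KEq.refl _
      · have hx' := insRow_bump_mem x r x' hq
        rcases r with _ | ⟨c, r⟩
        · simp [insRow] at hq
        · have hac := h.1 c (by simp)
          by_cases hcx : c ≤ x
          · simp only [insRow, hcx, if_true]
            exact KEq.k2 _ hac (by omega)
          · simp only [insRow, hcx, if_false]
            exact KEq.k2 _ hax (by omega)
    · simp only [insRow, hax, if_false]
      exact row_knuth_aux x r a (by omega) h'

/-- Row reading word of a tableau (rows from bottom to top). -/
def rowRead : List (List ℕ) → List ℕ
  | [] => []
  | r :: t => rowRead t ++ r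

theorem insTab_knuth (t : List (List ℕ)) : ∀ x : ℕ, (∀ r ∈ t, r.Pairwise (· ≤ ·)) →
    KEq (rowRead t ++ [x]) (rowRead (insTab t x)) := by
  induction t with
  | nil => intro x _; exact KEq.refl _
  | cons r t ih =>
    intro x h
    have h1 := (row_knuth x r (h r (by simp))).left (rowRead t)
    rw [insTab_cons]
    simp only [rowRead, List.append_assoc]
    refine h1.trans ?_
    rcases hq : (insRow x r).2 with _ | y
    · exact KEq.refl _
    · have := (ih y (fun s hs => h s (by simp [hs]))).right (insRow x r).1
      simpa using this

theorem insTab_rows (t : List (List ℕ)) : ∀ x : ℕ, (∀ r ∈ t, r.Pairwise (· ≤ ·)) →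
    ∀ r ∈ insTab t x, r.Pairwise (· ≤ ·) := by
  induction t with
  | nil => intro x _; simp [insTab]
  | cons r t ih =>
    intro x h
    rw [insTab_cons]
    intro s hs
    rw [List.mem_cons] at hs
    rcases hs with rfl | hs
    · exact insRow_sorted x r (h r (by simp))
    · rcases hq : (insRow x r).2 with _ | y
      · rw [hq] at hs
        exact h s (by simp at hs; simp [hs])
      · rw [hq] at hs
        exact ih y (fun s hs => h s (by simp [hs])) s (by simpa using hs)

theorem pWord_append_singleton (w : List ℕ) (x : ℕ) : pWord (w ++ [x]) = insTab (pWord w) x := by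
  simp [pWord]

theorem pWord_rows (w : List ℕ) : ∀ r ∈ pWord w, r.Pairwise (· ≤ ·) := by
  induction w using List.reverseRecOn with
  | nil => simp [pWord]
  | append_singleton w x ih => rw [pWord_append_singleton]; exact insTab_rows _ x ih

theorem knuth_rowRead (w : List ℕ) : KEq w (rowRead (pWord w)) := by
  induction w using List.reverseRecOn with
  | nil => exact KEq.refl _
  | append_singleton w x ih =>
    rw [pWord_append_singleton]
    exact (ih.right [x]).trans (insTab_knuth _ x (pWord_rows w))

/-! ### The column condition -/

/-- `s` fits strictly below `r`. -/
inductive Dom : List ℕ → List ℕ → Prop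
  | nil (r : List ℕ) : Dom r []
  | cons (a b : ℕ) (r s : List ℕ) : a < b → Dom r s → Dom (a :: r) (b :: s)

theorem Dom.insRow_left {r s : List ℕ} (h : Dom r s) (x : ℕ) : Dom (insRow x r).1 s := by
  induction h with
  | nil r => exact Dom.nil _
  | cons a b r s hab h ih =>
    rw [insRow]
    split_ifs with hx
    · exact Dom.cons _ _ _ _ hab ih
    · exact Dom.cons _ _ _ _ (by omega) h

theorem Dom.insRow_both {r s : List ℕ} (h : Dom r s) (x y : ℕ) (hy : (insRow x r).2 = some y) :
    Dom (insRow x r).1 (insRow y s).1 := by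
  induction h with
  | nil r =>
    have hy' := insRow_bump_mem x r y hy
    cases r with
    | nil => simp [insRow] at hy
    | cons a r =>
      by_cases hx : a ≤ x
      · simp only [insRow, hx, if_true]
        exact Dom.cons _ _ _ _ (by omega) (Dom.nil _)
      · simp only [insRow, hx, if_false]
        exact Dom.cons _ _ _ _ (by omega) (Dom.nil _)
  | cons a b r s hab h ih =>
    have hy' := insRow_bump_mem x (a :: r) y hy
    by_cases hx : a ≤ x
    · simp only [insRow, hx, if_true] at hy ⊢
      by_cases hb : b ≤ y
      · simp only [hb, if_true]
        exact Dom.cons _ _ _ _ hab (ih hy)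
      · simp only [hb, if_false]
        exact Dom.cons _ _ _ _ (by omega) (h.insRow_left x)
    · simp only [insRow, hx, if_false, Option.some.injEq] at hy ⊢
      subst hy
      have hb : ¬ b ≤ a := by omega
      simp only [hb, if_false]
      exact Dom.cons _ _ _ _ (by omega) h

/-- Column-strict tableaux: consecutive rows dominate. -/
inductive ColOK : List (List ℕ) → Prop
  | nil : ColOK []
  | single (r : List ℕ) : ColOK [r]
  | cons (r s : List ℕ) (t : List (List ℕ)) : Dom r s → ColOK (s :: t) → ColOK (r :: s :: t)

theorem insTab_colOK (t : List (List ℕ)) : ∀ x : ℕ, ColOK t → ColOK (insTab t x) := by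
  induction t with
  | nil => intro x _; exact ColOK.single _
  | cons r t ih =>
    intro x h
    rw [insTab_cons]
    rcases hq : (insRow x r).2 with _ | y
    · cases h with
      | single r => exact ColOK.single _
      | cons r s t h1 h2 => exact ColOK.cons _ _ _ (h1.insRow_left x) h2
    · cases h with
      | single r =>
        exact ColOK.cons _ _ _ ((Dom.nil r).insRow_both x y hq) (ColOK.single _)
      | cons r s t h1 h2 =>
        have := ih y h2
        simp only [Option.toList_some, List.foldl_cons, List.foldl_nil]
        rw [insTab_cons] at this ⊢
        exact ColOK.cons _ _ _ (h1.insRow_both x y hq) this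

theorem pWord_colOK (w : List ℕ) : ColOK (pWord w) := by
  induction w using List.reverseRecOn with
  | nil => exact ColOK.nil
  | append_singleton w x ih => rw [pWord_append_singleton]; exact insTab_colOK _ x ih

/-! ### Inserting the reversed reading word gives the transpose -/

/-- Concatenate two lists of columns entrywise. -/
def mergeCols : List (List ℕ) → List (List ℕ) → List (List ℕ)
  | [], W => W
  | c :: V, [] => c :: V
  | c :: V, d :: W => (c ++ d) :: mergeCols V W

theorem mergeCols_nil (V : List (List ℕ)) : mergeCols V [] = V := by
  cases V <;> rfl

theorem mergeCols_assoc : ∀ (A B C : List (List ℕ)),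
    mergeCols (mergeCols A B) C = mergeCols A (mergeCols B C) := by
  intro A
  induction A with
  | nil => intro B C; rfl
  | cons a A ih =>
    intro B C
    cases B with
    | nil => cases C <;> simp [mergeCols]
    | cons b B => cases C <;> simp [mergeCols, ih]

/-- A row as a list of one-element columns. -/
def rowCols (r : List ℕ) : List (List ℕ) := r.map fun a => [a]

theorem foldl_mergeCols (U : List (List ℕ)) : ∀ V : List (List ℕ),
    U.foldl (fun V r => mergeCols V (rowCols r)) V =
      mergeCols V (U.foldr (fun r V => mergeCols (rowCols r) V) []) := by
  induction U with
  | nil => intro V; simp [mergeCols_nil]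
  | cons r U ih => intro V; simp [ih, mergeCols_assoc]

theorem mapM_pop (V : List (List ℕ)) : ∀ l : List ℕ,
    ((V.mapM (m := StateM (List ℕ)) List.transpose.pop) l).1 ++
      rowCols ((V.mapM (m := StateM (List ℕ)) List.transpose.pop) l).2 =
      mergeCols (rowCols l) V := by
  induction V with
  | nil => intro l; simp [mergeCols_nil]; rfl
  | cons c V ih =>
    intro l
    rw [List.mapM_cons]
    cases l with
    | nil =>
      have := ih []
      simp only [rowCols, List.map_nil, mergeCols] at this ⊢
      exact congrArg (c :: ·) this
    | cons a l =>
      have := ih l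
      simp only [rowCols, List.map_cons, mergeCols] at this ⊢
      exact congrArg ((a :: c) :: ·) this

theorem foldl_push (l : List ℕ) : ∀ acc : Array (List ℕ),
    (l.foldl (fun arr a => arr.push [a]) acc).toList = acc.toList ++ rowCols l := by
  induction l with
  | nil => intro acc; simp [rowCols]
  | cons a l ih => intro acc; simp [rowCols]

theorem transpose_go (l : List ℕ) (acc : Array (List ℕ)) :
    (List.transpose.go l acc).toList = mergeCols (rowCols l) acc.toList := by
  rw [← mapM_pop]
  unfold List.transpose.go
  rw [Array.mapM_eq_mapM_toList]
  exact foldl_push _ _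

theorem transpose_eq (U : List (List ℕ)) :
    U.transpose = U.foldr (fun r V => mergeCols (rowCols r) V) [] := by
  unfold List.transpose
  induction U with
  | nil => rfl
  | cons r U ih => rw [List.foldr_cons, List.foldr_cons, transpose_go, ih]

theorem insRow_append_bump (a b : ℕ) (hab : a < b) (c : List ℕ) (hc : ∀ x ∈ c, x ≤ a) :
    insRow a (c ++ [b]) = (c ++ [a], some b) := by
  induction c with
  | nil => simp [insRow, hab.not_ge]
  | cons d c ih =>
    have hd : d ≤ a := hc d (by simp)
    simp only [List.cons_append, insRow, hd, if_true]
    rw [ih (fun x hx => hc x (by simp [hx]))]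

theorem insRow_append_end (a : ℕ) (c : List ℕ) (hc : ∀ x ∈ c, x ≤ a) :
    insRow a c = (c ++ [a], none) := by
  induction c with
  | nil => simp [insRow]
  | cons d c ih =>
    have hd : d ≤ a := hc d (by simp)
    simp only [List.cons_append, insRow, hd, if_true]
    rw [ih (fun x hx => hc x (by simp [hx]))]

theorem scanRow_reverse (c : List ℕ) : ∀ (r : List ℕ) (a : ℕ), (∀ x ∈ c, x ≤ a) →
    (a :: r).Pairwise (· < ·) → scanRow c (a :: r).reverse = (c ++ [a], r.reverse) := by
  intro r
  induction r with
  | nil => intro a hc _; simp [scanRow, insRow_append_end a c hc]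
  | cons b r ih =>
    intro a hc h
    rw [List.pairwise_cons] at h
    have hab := h.1 b (by simp)
    rw [List.reverse_cons, scanRow_append, ih b (fun x hx => (hc x hx).trans hab.le) h.2]
    simp [scanRow, insRow_append_bump a b hab c hc]

/-- The columns `V` lie above the row `r`. -/
def Below : List (List ℕ) → List ℕ → Prop
  | [], _ => True
  | _ :: _, [] => True
  | c :: V, a :: r => (∀ x ∈ c, x ≤ a) ∧ Below V r

theorem foldl_reverse_row (r : List ℕ) : ∀ V : List (List ℕ), r.Pairwise (· < ·) → Below V r →
    r.reverse.foldl insTab V = mergeCols V (rowCols r) := by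
  induction r with
  | nil => intro V _ _; simp [rowCols, mergeCols_nil]
  | cons a r ih =>
    intro V h hb
    have h2 := (List.pairwise_cons.1 h).2
    cases V with
    | nil =>
      have hs := scanRow_reverse [] r a (by simp) h
      change pWord (a :: r).reverse = _
      rcases hw : (a :: r).reverse with _ | ⟨x, w⟩
      · simp at hw
      · rw [pWord_cons, ← hw, hs]
        change _ :: r.reverse.foldl insTab [] = _
        rw [ih [] h2 trivial]
        rfl
    | cons c V =>
      rw [foldl_insTab_cons, scanRow_reverse c r a hb.1 h, ih V h2 hb.2]
      rfl

theorem Below.step {r s : List ℕ} (h : Dom r s) : ∀ V : List (List ℕ), Below V r →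
    Below (mergeCols V (rowCols r)) s := by
  induction h with
  | nil r => intro V _; cases mergeCols V (rowCols r) <;> trivial
  | cons a b r s hab h ih =>
    intro V hb
    cases V with
    | nil =>
      refine ⟨by simp; omega, ?_⟩
      exact ih [] trivial
    | cons c V =>
      refine ⟨?_, ih V hb.2⟩
      intro x hx
      simp at hx
      rcases hx with hx | rfl
      · exact (hb.1 x hx).trans hab.le
      · exact hab.le

theorem foldl_reverse_tab (U : List (List ℕ)) : ∀ V : List (List ℕ),
    (∀ r ∈ U, r.Pairwise (· < ·)) → ColOK U → (∀ r ∈ U.head?, Below V r) →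
    (rowRead U).reverse.foldl insTab V = U.foldl (fun V r => mergeCols V (rowCols r)) V := by
  induction U with
  | nil => intro V _ _ _; rfl
  | cons r U ih =>
    intro V hr hc hb
    have hb' : Below V r := hb r (by simp)
    rw [rowRead, List.reverse_append, List.foldl_append,
      foldl_reverse_row r V (hr r (by simp)) hb', List.foldl_cons]
    refine ih _ (fun s hs => hr s (by simp [hs])) ?_ ?_
    · cases hc with
      | single r => exact ColOK.nil
      | cons r s t h1 h2 => exact h2
    · cases hc with
      | single r => simp
      | cons r s t h1 h2 =>
        intro q hq
        simp at hq
        subst hq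
        exact Below.step h1 V hb'

theorem rowRead_sublist (U : List (List ℕ)) : ∀ r ∈ U, r.Sublist (rowRead U) := by
  induction U with
  | nil => simp
  | cons s U ih =>
    intro r hr
    rw [rowRead]
    rcases List.mem_cons.1 hr with rfl | hr
    · exact List.sublist_append_right _ _
    · exact (ih r hr).trans (List.sublist_append_left _ _)

/-- Schensted: reversing a word with distinct letters transposes the insertion tableau. -/
theorem pWord_reverse (w : List ℕ) (hw : w.Nodup) : pWord w.reverse = (pWord w).transpose := by
  have hk := knuth_rowRead w
  rw [KEq.pWord_eq _ le_rfl (hk.reverse hw), transpose_eq]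
  have hn := hk.perm.nodup_iff.1 hw
  rw [pWord, foldl_reverse_tab _ [] _ (pWord_colOK w) (fun _ _ => trivial), foldl_mergeCols]
  · rfl
  · intro r hr
    have h1 := pWord_rows w r hr
    have h2 : r.Nodup := hn.sublist (rowRead_sublist _ r hr)
    exact (h1.and h2).imp (fun h => lt_of_le_of_ne h.1 h.2)

/-! ### Reading words of a skew tableau -/

/-- `a` is weakly below and weakly left of `b`. -/
def SWle (a b : ℕ × ℕ) : Prop := b.1 ≤ a.1 ∧ a.2 ≤ b.2

/-- An initial segment of a reading order. -/
def GoodList (s : SkewShape) (L : List (ℕ × ℕ)) : Prop :=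
  L.Pairwise (fun a b => ¬ SWle a b) ∧ (∀ x ∈ L, x ∈ s.cells) ∧
    ∀ x ∈ L, ∀ y ∈ s.cells, SWle x y → y ∈ L

theorem cells_convex (s : SkewShape) {a b c : ℕ × ℕ} (ha : a ∈ s.cells) (hc : c ∈ s.cells)
    (hab : a ≤ b) (hbc : b ≤ c) : b ∈ s.cells := by
  simp only [SkewShape.cells, Finset.mem_sdiff] at ha hc ⊢
  exact ⟨s.outer.isLowerSet hbc hc.1, fun hb => ha.2 (s.inner.isLowerSet hab hb)⟩

theorem syt_row {s : SkewShape} {n : ℕ} {T : ℕ × ℕ → Fin n} (hT : IsSYT s n T) (i j : ℕ) :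
    ∀ k, (i, j) ∈ s.cells → (i, j + k) ∈ s.cells → T (i, j) ≤ T (i, j + k) := by
  intro k
  induction k with
  | zero => intro _ _; exact le_rfl
  | succ k ih =>
    intro h1 h2
    have h3 : (i, j + k) ∈ s.cells :=
      cells_convex s h1 h2 (Prod.mk_le_mk.2 ⟨le_rfl, by omega⟩) (Prod.mk_le_mk.2 ⟨le_rfl, by omega⟩)
    exact (ih h1 h3).trans (hT.2.1 i (j + k) h3 h2).le

theorem syt_col {s : SkewShape} {n : ℕ} {T : ℕ × ℕ → Fin n} (hT : IsSYT s n T) (i j : ℕ) :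
    ∀ k, (i, j) ∈ s.cells → (i + k, j) ∈ s.cells → T (i, j) ≤ T (i + k, j) := by
  intro k
  induction k with
  | zero => intro _ _; exact le_rfl
  | succ k ih =>
    intro h1 h2
    have h3 : (i + k, j) ∈ s.cells :=
      cells_convex s h1 h2 (Prod.mk_le_mk.2 ⟨by omega, le_rfl⟩) (Prod.mk_le_mk.2 ⟨by omega, le_rfl⟩)
    exact (ih h1 h3).trans (hT.2.2 (i + k) j h3 h2).le

theorem syt_lt {s : SkewShape} {n : ℕ} {T : ℕ × ℕ → Fin n} (hT : IsSYT s n T) {a b : ℕ × ℕ}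
    (ha : a ∈ s.cells) (hb : b ∈ s.cells) (hab : a ≤ b) (hne : a ≠ b) : T a < T b := by
  obtain ⟨i, j⟩ := a
  obtain ⟨i', j'⟩ := b
  obtain ⟨hi, hj⟩ := Prod.mk_le_mk.1 hab
  obtain ⟨k, rfl⟩ := Nat.exists_eq_add_of_le hi
  obtain ⟨l, rfl⟩ := Nat.exists_eq_add_of_le hj
  have hc : (i, j + l) ∈ s.cells :=
    cells_convex s ha hb (Prod.mk_le_mk.2 ⟨le_rfl, by omega⟩) (Prod.mk_le_mk.2 ⟨by omega, le_rfl⟩)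
  have h := (syt_row hT i j l ha hc).trans (syt_col hT i (j + l) k hc hb)
  exact lt_of_le_of_ne h (fun e => hne (hT.1.injOn ha hb e))

theorem GoodList.nodup {s : SkewShape} {L : List (ℕ × ℕ)} (h : GoodList s L) : L.Nodup := by
  refine List.Pairwise.imp ?_ h.1
  rintro a b hab rfl
  exact hab ⟨le_rfl, le_rfl⟩

theorem GoodList.last {s : SkewShape} {M : List (ℕ × ℕ)} {x : ℕ × ℕ}
    (h : GoodList s (M ++ [x])) : ∀ c ∈ M, ¬ SWle c x := by
  intro c hc
  exact (List.pairwise_append.1 h.1).2.2 c hc x (by simp)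

theorem GoodList.front {s : SkewShape} {M : List (ℕ × ℕ)} {x : ℕ × ℕ}
    (h : GoodList s (M ++ [x])) : GoodList s M := by
  refine ⟨(List.pairwise_append.1 h.1).1, fun y hy => h.2.1 y (by simp [hy]), ?_⟩
  intro y hy z hz hyz
  have h1 := h.2.2 y (by simp [hy]) z hz hyz
  simp at h1
  rcases h1 with h1 | rfl
  · exact h1
  · exact absurd hyz (h.last y hy)

/-- The word of a list of cells. -/
def cellWord {n : ℕ} (T : ℕ × ℕ → Fin n) (L : List (ℕ × ℕ)) : List ℕ := L.map fun c => (T c : ℕ)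

/-- The key step: `x` strictly north-west of `y`. -/
theorem good_step {s : SkewShape} {n : ℕ} {T : ℕ × ℕ → Fin n} (hT : IsSYT s n T)
    {M₁ M₂ : List (ℕ × ℕ)} {x y : ℕ × ℕ} (h1 : GoodList s (M₁ ++ [x]))
    (h2 : GoodList s (M₂ ++ [y])) (hp : (M₁ ++ [x]).Perm (M₂ ++ [y]))
    (hi : x.1 < y.1) (hj : x.2 < y.2) :
    ∃ N : List (ℕ × ℕ), ∃ b : ℕ × ℕ, T x < T b ∧ T b < T y ∧
      GoodList s (N ++ [b, y]) ∧ GoodList s (N ++ [b, x]) ∧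
      M₁.Perm (N ++ [b, y]) ∧ M₂.Perm (N ++ [b, x]) := by
  have hxy : x ≠ y := by rintro rfl; omega
  have hx : x ∈ s.cells := h1.2.1 x (by simp)
  have hy : y ∈ s.cells := h2.2.1 y (by simp)
  have hx2 : x ∈ M₂ := by
    have : x ∈ M₂ ++ [y] := hp.subset (by simp)
    simpa [hxy] using this
  have hM2 : GoodList s M₂ := h2.front
  -- the remaining cells
  set M := M₂.erase x with hM
  have hperm2 : M₂.Perm (x :: M) := List.perm_cons_erase hx2
  have hnd : (x :: M).Nodup := hperm2.nodup_iff.1 hM2.nodup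
  have hxM : x ∉ M := (List.nodup_cons.1 hnd).1
  have hperm1 : M₁.Perm (y :: M) := by
    have e1 : (M₁ ++ [x]).Perm (x :: M₁) := List.perm_append_singleton x M₁
    have e2 : (M₂ ++ [y]).Perm (y :: M₂) := List.perm_append_singleton y M₂
    have e3 : (x :: M₁).Perm (x :: y :: M) :=
      e1.symm.trans (hp.trans (e2.trans ((hperm2.cons y).trans (List.Perm.swap x y M))))
    exact e3.cons_inv
  have hMM1 : ∀ c ∈ M, c ∈ M₁ := fun c hc => hperm1.symm.subset (by simp [hc])
  have hMM2 : ∀ c ∈ M, c ∈ M₂ := fun c hc => hperm2.symm.subset (by simp [hc])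
  have hMx : ∀ c ∈ M, ¬ SWle c x := fun c hc => h1.last c (hMM1 c hc)
  have hMy : ∀ c ∈ M, ¬ SWle c y := fun c hc => h2.last c (hMM2 c hc)
  -- the corner
  have hk : (x.1, y.2) ∈ s.cells :=
    cells_convex s hx hy (Prod.mk_le_mk.2 ⟨le_rfl, hj.le⟩) (Prod.mk_le_mk.2 ⟨hi.le, le_rfl⟩)
  have hkM : (x.1, y.2) ∈ M := by
    have h3 : (x.1, y.2) ∈ M₁ ++ [x] := h1.2.2 x (by simp) _ hk ⟨le_rfl, hj.le⟩
    have h4 : (x.1, y.2) ∈ M₁ := by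
      rcases List.mem_append.1 h3 with h | h
      · exact h
      · have := congrArg Prod.snd (List.mem_singleton.1 h)
        simp at this; omega
    rcases List.mem_cons.1 (hperm1.subset h4) with h | h
    · have := congrArg Prod.fst h
      simp at this; omega
    · exact h
  classical
  obtain ⟨b, hb, hmax⟩ := Finset.exists_max_image
    (M.toFinset.filter fun c => SWle c (x.1, y.2)) (fun c => (c.1 : ℤ) - c.2)
    ⟨_, Finset.mem_filter.2 ⟨List.mem_toFinset.2 hkM, le_rfl, le_rfl⟩⟩
  obtain ⟨hbM, hbk⟩ := Finset.mem_filter.1 hb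
  rw [List.mem_toFinset] at hbM
  have hbmax : ∀ c ∈ M, SWle c b → c = b := by
    intro c hc hcb
    have := hmax c (Finset.mem_filter.2 ⟨List.mem_toFinset.2 hc,
      hbk.1.trans hcb.1, hcb.2.trans hbk.2⟩)
    obtain ⟨e1, e2⟩ := hcb
    ext <;> omega
  have hbc : b ∈ s.cells := hM2.2.1 b (hMM2 b hbM)
  have hbx := hMx b hbM
  have hby := hMy b hbM
  simp only [SWle] at hbk hbx hby
  refine ⟨M.erase b, b, ?_, ?_, ?_, ?_, ?_, ?_⟩
  · exact syt_lt hT hx hbc (Prod.le_def.2 ⟨by omega, by omega⟩) (by rintro rfl; omega)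
  · exact syt_lt hT hbc hy (Prod.le_def.2 ⟨by omega, by omega⟩) (by rintro rfl; omega)
  all_goals
    have hMnd : M.Nodup := (List.nodup_cons.1 hnd).2
    have hNM : ∀ c ∈ M.erase b, c ∈ M ∧ c ≠ b := fun c hc =>
      ⟨List.mem_of_mem_erase hc, fun e => by subst e; exact hMnd.not_mem_erase hc⟩
    have hNb : (M.erase b ++ [b]).Perm M :=
      (List.perm_append_singleton b _).trans (List.perm_cons_erase hbM).symm
    have hq : ∀ z, (M.erase b ++ [b, z]).Perm (z :: M) := fun z => by
      have e : M.erase b ++ [b, z] = (M.erase b ++ [b]) ++ [z] := by simp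
      rw [e]
      exact (List.perm_append_singleton z _).trans (hNb.cons z)
    have hpw : ∀ z, (∀ c ∈ M, ¬ SWle c z) →
        (M.erase b ++ [b, z]).Pairwise (fun a b => ¬ SWle a b) := fun z hz => by
      rw [List.pairwise_append]
      refine ⟨(hM2.1.sublist List.erase_sublist).sublist List.erase_sublist, ?_, ?_⟩
      · simp [hz b hbM]
      · intro c hc d hd
        simp at hd
        rcases hd with rfl | rfl
        · exact fun h => (hNM c hc).2 (hbmax c (hNM c hc).1 h)
        · exact hz c (hNM c hc).1
  · refine ⟨hpw y hMy, ?_, ?_⟩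
    · intro c hc
      exact h1.front.2.1 c (hperm1.symm.subset ((hq y).subset hc))
    · intro c hc d hd hcd
      exact (hq y).symm.subset (hperm1.subset
        (h1.front.2.2 c (hperm1.symm.subset ((hq y).subset hc)) d hd hcd))
  · refine ⟨hpw x hMx, ?_, ?_⟩
    · intro c hc
      exact hM2.2.1 c (hperm2.symm.subset ((hq x).subset hc))
    · intro c hc d hd hcd
      exact (hq x).symm.subset (hperm2.subset
        (hM2.2.2 c (hperm2.symm.subset ((hq x).subset hc)) d hd hcd))
  · exact hperm1.trans (hq y).symm
  · exact hperm2.trans (hq x).symm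

theorem pWord_snoc_congr {u v : List ℕ} (h : pWord u = pWord v) (x : ℕ) :
    pWord (u ++ [x]) = pWord (v ++ [x]) := by
  rw [pWord_append_singleton, pWord_append_singleton, h]

theorem good_eq {s : SkewShape} {n : ℕ} {T : ℕ × ℕ → Fin n} (hT : IsSYT s n T) :
    ∀ (m : ℕ) (L₁ L₂ : List (ℕ × ℕ)), L₁.length = m → GoodList s L₁ → GoodList s L₂ →
      L₁.Perm L₂ → pWord (cellWord T L₁) = pWord (cellWord T L₂) := by
  intro m
  induction m with
  | zero =>
    intro L₁ L₂ hl _ _ hp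
    have hl2 := hp.length_eq
    rw [List.length_eq_zero_iff.1 hl, List.length_eq_zero_iff.1 (by omega : L₂.length = 0)]
  | succ m ih =>
    intro L₁ L₂ hl h1 h2 hp
    have hl2 := hp.length_eq
    rcases List.eq_nil_or_concat L₁ with rfl | ⟨M₁, x, rfl⟩
    · simp at hl
    rcases List.eq_nil_or_concat L₂ with rfl | ⟨M₂, y, rfl⟩
    · simp at hl2
    simp only [List.concat_eq_append] at *
    have hm1 : M₁.length = m := by simpa using hl
    have hm2 : M₂.length = m := by simp at hl2; omega
    have hsn : ∀ (M : List (ℕ × ℕ)) z, cellWord T (M ++ [z]) = cellWord T M ++ [(T z : ℕ)] := by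
      intro M z; simp [cellWord]
    have key : ∀ (M₁ M₂ : List (ℕ × ℕ)) (x y : ℕ × ℕ), M₁.length = m → M₂.length = m →
        GoodList s (M₁ ++ [x]) → GoodList s (M₂ ++ [y]) → (M₁ ++ [x]).Perm (M₂ ++ [y]) →
        x.1 < y.1 → x.2 < y.2 →
        pWord (cellWord T (M₁ ++ [x])) = pWord (cellWord T (M₂ ++ [y])) := by
      intro M₁ M₂ x y hm1 hm2 h1 h2 hp hi hj
      obtain ⟨N, b, hxb, hby, g1, g2, p1, p2⟩ := good_step hT h1 h2 hp hi hj
      rw [hsn, hsn, pWord_snoc_congr (ih M₁ _ hm1 h1.front g1 p1),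
        pWord_snoc_congr (ih M₂ _ hm2 h2.front g2 p2)]
      refine (KEq.pWord_eq _ le_rfl ?_).symm
      have := (KEq.k1 (x := T x) (y := T b) (z := T y) [] hxb hby.le).left (cellWord T N)
      simpa [cellWord] using this
    by_cases hxy : x = y
    · subst hxy
      have hpm : M₁.Perm M₂ := (List.perm_append_right_iff [x]).1 hp
      rw [hsn, hsn]
      exact pWord_snoc_congr (ih M₁ M₂ hm1 h1.front h2.front hpm) _
    · have hx2 : x ∈ M₂ := by
        have : x ∈ M₂ ++ [y] := hp.subset (by simp)
        simpa [hxy] using this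
      have hy1 : y ∈ M₁ := by
        have : y ∈ M₁ ++ [x] := hp.symm.subset (by simp)
        simpa [Ne.symm hxy] using this
      have e1 := h2.last x hx2
      have e2 := h1.last y hy1
      simp only [SWle] at e1 e2
      rcases lt_or_ge x.1 y.1 with hi | hi
      · exact key M₁ M₂ x y hm1 hm2 h1 h2 hp hi (by omega)
      · exact (key M₂ M₁ y x hm2 hm1 h2 h1 hp.symm (by omega) (by omega)).symm

/-- The list of cells in the order of a distinguished labeling. -/
theorem reading_list {s : SkewShape} {n : ℕ} {T τ : ℕ × ℕ → Fin n} (hb : IsBijFilling s n τ)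
    (hd : ∀ B ∈ s.cells, ∀ B' ∈ s.cells, B'.1 ≤ B.1 → B.2 ≤ B'.2 → τ B' ≤ τ B)
    {π : Equiv.Perm (Fin n)} (hπ : IsReading s τ T π) :
    ∃ L, GoodList s L ∧ (∀ c, c ∈ L ↔ c ∈ s.cells) ∧
      (List.ofFn fun i => (π i : ℕ)) = cellWord T L := by
  have hsurj : ∀ i, ∃ c ∈ s.cells, τ c = i := fun i => by
    obtain ⟨c, hc, h⟩ := hb.surjOn (Set.mem_univ i)
    exact ⟨c, hc, h⟩
  choose f hf hτ using hsurj
  have hmem : ∀ c, c ∈ List.ofFn f ↔ c ∈ s.cells := by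
    intro c
    rw [List.mem_ofFn]
    constructor
    · rintro ⟨i, rfl⟩; exact hf i
    · intro hc
      exact ⟨τ c, hb.injOn (hf _) hc (hτ _)⟩
  refine ⟨List.ofFn f, ⟨?_, fun x hx => (hmem x).1 hx, fun x _ y hy _ => (hmem y).2 hy⟩, hmem, ?_⟩
  · rw [List.pairwise_ofFn]
    intro i j hij hsw
    have := hd _ (hf i) _ (hf j) hsw.1 hsw.2
    rw [hτ, hτ] at this
    exact absurd hij this.not_gt
  · simp only [cellWord, List.map_ofFn]
    congr 1
    funext i
    have := hπ _ (hf i)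
    rw [hτ] at this
    simp [this]

/-- For a standard Young tableau `T` of shape `λ/μ` and any distinguished Schur labeling
`τ` of that shape, the insertion tableau of `read_τ(T)` equals the transpose of the
rectification of `T`:  `P(read_τ(T)) = Rect(T)ᵗ`.  In particular it is independent of
the choice of distinguished Schur labeling `τ`. -/
theorem ptab_reading_eq_rect_transpose (s : SkewShape) (n : ℕ)
    (T : ℕ × ℕ → Fin n) (hT : IsSYT s n T)
    (τ : ℕ × ℕ → Fin n) (hτ : IsDistinguished s n τ)
    (τ₀ : ℕ × ℕ → Fin n) (h0 : IsTau0 s n τ₀)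
    (π π₀ : Equiv.Perm (Fin n)) (hπ : IsReading s τ T π) (hπ₀ : IsReading s τ₀ T π₀) :
    Ptab π = (RectOf π₀).transpose := by

  obtain ⟨L, g, hm, e⟩ := reading_list hτ.1.1 hτ.2 hπ
  have hd0 : ∀ B ∈ s.cells, ∀ B' ∈ s.cells, B'.1 ≤ B.1 → B.2 ≤ B'.2 → τ₀ B' ≤ τ₀ B := by
    intro B hB B' hB' h1 h2
    by_cases hne : B' = B
    · rw [hne]
    · refine ((h0.2 B' hB' B hB hne).2 ?_).le
      rcases h1.lt_or_eq with h | h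
      · exact Or.inl h
      · refine Or.inr ⟨h, lt_of_le_of_ne h2 fun h' => hne (Prod.ext h h'.symm)⟩
  obtain ⟨L₀, g₀, hm₀, e₀⟩ := reading_list h0.1 hd0 hπ₀
  have hp : L.Perm L₀ := (List.perm_ext_iff_of_nodup g.nodup g₀.nodup).2
    (fun c => (hm c).trans (hm₀ c).symm)
  have h1 : Ptab π = pWord (List.ofFn fun i => (π₀ i : ℕ)) := by
    change pWord (List.ofFn fun i => (π i : ℕ)) = _
    rw [e, e₀, good_eq hT _ L L₀ rfl g g₀ hp]
  have h2 : RectOf π₀ = pWord (List.ofFn fun i => (π₀ i : ℕ)).reverse := by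
    change pWord (List.ofFn fun i => ((π₀ * w0 n) i : ℕ)) = _
    congr 1
    apply List.ext_getElem
    · simp
    · intro i h h'
      simp [w0, Fin.rev]
      congr 2
      ext
      simp
      omega
  have hnd : (List.ofFn fun i => (π₀ i : ℕ)).Nodup :=
    List.nodup_ofFn.2 (fun i j h => π₀.injective (Fin.ext h))
  rw [h1, h2, ← pWord_reverse _ (List.nodup_reverse.2 hnd), List.reverse_reverse]
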